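/- Let H be a real Hilbert space and T : H → H a bounded self-adjoint positive linear operator. Suppose v₀ ∈ H is a unit vector with T v₀ = μ₀ v₀, v₁ ∈ H is a unit vector orthogonal to v₀ with T v₁ = μ₁ v₁, where 0 < μ₁ < μ₀, and there exists κ with 0 ≤ κ < μ₁ such that ‖T w‖ ≤ κ‖w‖ for every w ∈ H orthogonal to both v₀ and v₁. Let x⁰, x¹ ∈ H with c₀ := ⟪v₀, x⁰⟫ ≠ 0, and for each p define the Gram–Schmidt orthogonalized iterate Y_p := T^p x¹ − (⟪T^p x⁰, T^p x¹⟫ / ‖T^p x⁰‖²) T^p x⁰. Then μ₁^{−p} Y_p converges in H, as p → ∞, to (⟪v₁, x¹⟫ − ⟪v₀, x¹⟫ ⟪v₁, x⁰⟫ / ⟪v₀, x⁰⟫) v₁; in particular, when this coefficient is nonzero the normalized vectors Y_p/‖Y_p‖ converge to ±v₁. -/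

import Mathlib

open Filter
open scoped RealInnerProductSpace Topology

section

variable {H : Type*} [NormedAddCommGroup H] [InnerProductSpace ℝ H]

lemma pow_apply_eigenvector {T : H →L[ℝ] H} {v : H} {μ : ℝ} (h : T v = μ • v) (p : ℕ) :
    (T ^ p) v = μ ^ p • v := by
  induction p with
  | zero => simp
  | succ p ih => rw [pow_succ, mul_apply_eq_comp, h, map_smul, ih, smul_smul, pow_succ']

lemma inner_apply_eigenvector_eq_zero {T : H →L[ℝ] H} (hsa : ∀ x y : H, ⟪T x, y⟫ = ⟪x, T y⟫)
    {v w : H} {μ : ℝ} (h : T v = μ • v) (hw : ⟪v, w⟫ = 0) : ⟪v, T w⟫ = 0 := by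
  rw [← hsa, h, real_inner_smul_left, hw, mul_zero]

lemma norm_pow_apply_le_of_orthogonal {T : H →L[ℝ] H} (hsa : ∀ x y : H, ⟪T x, y⟫ = ⟪x, T y⟫)
    {v₀ v₁ : H} {μ₀ μ₁ κ : ℝ} (hv₀ : T v₀ = μ₀ • v₀) (hv₁ : T v₁ = μ₁ • v₁) (hκ : 0 ≤ κ)
    (hgap : ∀ w : H, ⟪v₀, w⟫ = 0 → ⟪v₁, w⟫ = 0 → ‖T w‖ ≤ κ * ‖w‖)
    (p : ℕ) {w : H} (hw₀ : ⟪v₀, w⟫ = 0) (hw₁ : ⟪v₁, w⟫ = 0) :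
    ‖(T ^ p) w‖ ≤ κ ^ p * ‖w‖ := by
  induction p generalizing w with
  | zero => simp
  | succ p ih =>
    rw [pow_succ, mul_apply_eq_comp]
    calc ‖(T ^ p) (T w)‖ ≤ κ ^ p * ‖T w‖ :=
          ih (inner_apply_eigenvector_eq_zero hsa hv₀ hw₀)
            (inner_apply_eigenvector_eq_zero hsa hv₁ hw₁)
      _ ≤ κ ^ p * (κ * ‖w‖) := by gcongr; exact hgap w hw₀ hw₁
      _ = κ ^ (p + 1) * ‖w‖ := by ring

/-- On the orthogonal complement of `v₀`, the power iterates rescaled by the second eigenvalue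
converge to the component along `v₁`. -/
lemma tendsto_inv_pow_smul_pow_apply_of_orthogonal {T : H →L[ℝ] H}
    (hsa : ∀ x y : H, ⟪T x, y⟫ = ⟪x, T y⟫) {v₀ v₁ : H} {μ₀ μ₁ κ : ℝ}
    (hTv₀ : T v₀ = μ₀ • v₀) (hTv₁ : T v₁ = μ₁ • v₁) (hv₁ : ‖v₁‖ = 1) (hperp : ⟪v₀, v₁⟫ = 0)
    (hκ : 0 ≤ κ) (hκμ : κ < μ₁)
    (hgap : ∀ w : H, ⟪v₀, w⟫ = 0 → ⟪v₁, w⟫ = 0 → ‖T w‖ ≤ κ * ‖w‖)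
    {z : H} (hz : ⟪v₀, z⟫ = 0) :
    Tendsto (fun p : ℕ => (μ₁ ^ p)⁻¹ • (T ^ p) z) atTop (𝓝 (⟪v₁, z⟫ • v₁)) := by
  have hμ : 0 < μ₁ := hκ.trans_lt hκμ
  set w : H := z - ⟪v₁, z⟫ • v₁ with hw
  have hw₀ : ⟪v₀, w⟫ = 0 := by simp [hw, inner_sub_right, real_inner_smul_right, hz, hperp]
  have hw₁ : ⟪v₁, w⟫ = 0 := by
    simp [hw, inner_sub_right, real_inner_smul_right, hv₁]
  have hsmall : Tendsto (fun p : ℕ => (μ₁ ^ p)⁻¹ • (T ^ p) w) atTop (𝓝 0) := by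
    have hratio : Tendsto (fun p : ℕ => (κ / μ₁) ^ p * ‖w‖) atTop (𝓝 0) := by
      simpa using (tendsto_pow_atTop_nhds_zero_of_lt_one (by positivity)
        ((div_lt_one hμ).2 hκμ)).mul_const ‖w‖
    refine squeeze_zero_norm (fun p => ?_) hratio
    rw [norm_smul, Real.norm_of_nonneg (by positivity), div_pow, div_eq_inv_mul, mul_assoc]
    gcongr
    exact norm_pow_apply_le_of_orthogonal hsa hTv₀ hTv₁ hκ hgap p hw₀ hw₁
  have hsplit : ∀ p : ℕ, ⟪v₁, z⟫ • v₁ + (μ₁ ^ p)⁻¹ • (T ^ p) w = (μ₁ ^ p)⁻¹ • (T ^ p) z := by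
    intro p
    have hne : μ₁ ^ p ≠ 0 := by positivity
    rw [hw, map_sub, map_smul, pow_apply_eigenvector hTv₁, smul_sub, smul_comm ⟪v₁, z⟫,
      inv_smul_smul₀ hne]
    abel
  simpa only [hsplit, add_zero] using hsmall.const_add (⟪v₁, z⟫ • v₁)

/-- The power iterates rescaled by the leading eigenvalue converge to the component along the
leading eigenvector. -/
lemma tendsto_inv_pow_smul_pow_apply {T : H →L[ℝ] H}
    (hsa : ∀ x y : H, ⟪T x, y⟫ = ⟪x, T y⟫) {v₀ v₁ : H} {μ₀ μ₁ κ : ℝ}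
    (hTv₀ : T v₀ = μ₀ • v₀) (hTv₁ : T v₁ = μ₁ • v₁) (hv₀ : ‖v₀‖ = 1) (hv₁ : ‖v₁‖ = 1)
    (hperp : ⟪v₀, v₁⟫ = 0) (hμ : μ₁ < μ₀) (hκ : 0 ≤ κ) (hκμ : κ < μ₁)
    (hgap : ∀ w : H, ⟪v₀, w⟫ = 0 → ⟪v₁, w⟫ = 0 → ‖T w‖ ≤ κ * ‖w‖) (x : H) :
    Tendsto (fun p : ℕ => (μ₀ ^ p)⁻¹ • (T ^ p) x) atTop (𝓝 (⟪v₀, x⟫ • v₀)) := by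
  have hμ₁ : 0 < μ₁ := hκ.trans_lt hκμ
  have hμ₀ : 0 < μ₀ := hμ₁.trans hμ
  set z : H := x - ⟪v₀, x⟫ • v₀ with hz
  have hz₀ : ⟪v₀, z⟫ = 0 := by simp [hz, inner_sub_right, real_inner_smul_right, hv₀]
  have hlim := (tendsto_pow_atTop_nhds_zero_of_lt_one (by positivity) ((div_lt_one hμ₀).2 hμ)).smul
    (tendsto_inv_pow_smul_pow_apply_of_orthogonal hsa hTv₀ hTv₁ hv₁ hperp hκ hκμ hgap hz₀)
  have hsplit : ∀ p : ℕ, ⟪v₀, x⟫ • v₀ + (μ₁ / μ₀) ^ p • (μ₁ ^ p)⁻¹ • (T ^ p) z =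
      (μ₀ ^ p)⁻¹ • (T ^ p) x := by
    intro p
    have hne₀ : μ₀ ^ p ≠ 0 := by positivity
    have hcoef : (μ₁ / μ₀) ^ p * (μ₁ ^ p)⁻¹ = (μ₀ ^ p)⁻¹ := by
      rw [div_pow]
      field_simp
    rw [smul_smul, hcoef, hz, map_sub, map_smul, pow_apply_eigenvector hTv₀, smul_sub,
      smul_comm ⟪v₀, x⟫, inv_smul_smul₀ hne₀]
    abel
  simpa only [hsplit, zero_smul, add_zero] using hlim.const_add (⟪v₀, x⟫ • v₀)

lemma sub_proj_sub_smul (x y : H) (s : ℝ) :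
    (y - s • x) - (⟪x, y - s • x⟫ / ‖x‖ ^ 2) • x = y - (⟪x, y⟫ / ‖x‖ ^ 2) • x := by
  rcases eq_or_ne x 0 with rfl | hx
  · simp
  · have hx' : ‖x‖ ^ 2 ≠ 0 := by positivity
    rw [inner_sub_right, real_inner_smul_right, real_inner_self_eq_norm_sq, sub_div,
      mul_div_cancel_right₀ _ hx']
    module

lemma sub_proj_smul_smul (x y : H) {r : ℝ} (hr : r ≠ 0) (t : ℝ) :
    t • y - (⟪r • x, t • y⟫ / ‖r • x‖ ^ 2) • r • x = t • (y - (⟪x, y⟫ / ‖x‖ ^ 2) • x) := by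
  rcases eq_or_ne x 0 with rfl | hx
  · simp
  · have hx' : ‖x‖ ≠ 0 := by positivity
    rw [real_inner_smul_left, real_inner_smul_right, norm_smul, mul_pow, Real.norm_eq_abs, sq_abs,
      smul_smul, smul_sub, smul_smul]
    congr 2
    field_simp

lemma inv_norm_smul_smul_of_pos {r : ℝ} (hr : 0 < r) (y : H) :
    ‖r • y‖⁻¹ • r • y = ‖y‖⁻¹ • y := by
  rw [norm_smul, Real.norm_of_nonneg hr.le, smul_smul]
  congr 1
  field_simp

end

/-- Power method with Gram–Schmidt orthogonalization for the first excited state: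
the rescaled orthogonalized iterates converge to the component of the second trial
vector along `v₁`, and when that component is nonzero the normalized iterates
converge to `±v₁`. -/
theorem gram_schmidt_power_iterates_tendsto
    {H : Type*} [NormedAddCommGroup H] [InnerProductSpace ℝ H] [CompleteSpace H]
    (T : H →L[ℝ] H)
    (hsa : ∀ x y : H, ⟪T x, y⟫ = ⟪x, T y⟫)
    (hpos : ∀ x : H, 0 ≤ ⟪x, T x⟫)
    (v₀ : H) (hv₀ : ‖v₀‖ = 1) (μ₀ : ℝ) (hTv₀ : T v₀ = μ₀ • v₀)
    (v₁ : H) (hv₁ : ‖v₁‖ = 1) (hperp : ⟪v₀, v₁⟫ = 0)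
    (μ₁ : ℝ) (hTv₁ : T v₁ = μ₁ • v₁)
    (hμ₁pos : 0 < μ₁) (hμ₁₀ : μ₁ < μ₀)
    (κ : ℝ) (hκ0 : 0 ≤ κ) (hκμ : κ < μ₁)
    (hgap : ∀ w : H, ⟪v₀, w⟫ = 0 → ⟪v₁, w⟫ = 0 → ‖T w‖ ≤ κ * ‖w‖)
    (x₀ x₁ : H) (hc₀ : ⟪v₀, x₀⟫ ≠ 0)
    (Y : ℕ → H)
    (hY : ∀ p : ℕ, Y p = (T ^ p) x₁ -
      (⟪(T ^ p) x₀, (T ^ p) x₁⟫ / ‖(T ^ p) x₀‖ ^ 2) • (T ^ p) x₀)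
    (c : ℝ) (hc : c = ⟪v₁, x₁⟫ - ⟪v₀, x₁⟫ * ⟪v₁, x₀⟫ / ⟪v₀, x₀⟫) :
    Tendsto (fun p : ℕ => (μ₁ ^ p)⁻¹ • Y p) atTop (𝓝 (c • v₁)) ∧
      (c ≠ 0 →
        Tendsto (fun p : ℕ => ‖Y p‖⁻¹ • Y p) atTop (𝓝 ((c / |c|) • v₁))) := by
  have hμ₀pos : 0 < μ₀ := hμ₁pos.trans hμ₁₀
  have hmain : Tendsto (fun p : ℕ => (μ₁ ^ p)⁻¹ • Y p) atTop (𝓝 (c • v₁)) := by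
    set s : ℝ := ⟪v₀, x₁⟫ / ⟪v₀, x₀⟫ with hs
    have hz₀ : ⟪v₀, x₁ - s • x₀⟫ = 0 := by
      rw [inner_sub_right, real_inner_smul_right, hs, div_mul_cancel₀ _ hc₀, sub_self]
    have hz₁ : ⟪v₁, x₁ - s • x₀⟫ = c := by
      rw [inner_sub_right, real_inner_smul_right, hs, hc]
      ring
    have hu := tendsto_inv_pow_smul_pow_apply hsa hTv₀ hTv₁ hv₀ hv₁ hperp hμ₁₀ hκ0 hκμ hgap x₀
    have ha := tendsto_inv_pow_smul_pow_apply_of_orthogonal hsa hTv₀ hTv₁ hv₁ hperp hκ0 hκμ hgap hz₀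
    rw [hz₁] at ha
    have hne : ‖⟪v₀, x₀⟫ • v₀‖ ^ 2 ≠ 0 := by simpa [norm_smul, hv₀] using hc₀
    have hlim := ha.sub (((hu.inner ha).div (hu.norm.pow 2) hne).smul hu)
    have hcoef : ⟪⟪v₀, x₀⟫ • v₀, c • v₁⟫ = 0 := by
      rw [real_inner_smul_left, real_inner_smul_right, hperp, mul_zero, mul_zero]
    rw [hcoef, zero_div, zero_smul, sub_zero] at hlim
    refine hlim.congr fun p => ?_
    have hne_inv : (μ₀ ^ p)⁻¹ ≠ 0 := by positivity
    rw [Pi.div_apply, sub_proj_smul_smul _ _ hne_inv, map_sub, map_smul, sub_proj_sub_smul, hY]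
  refine ⟨hmain, fun hcne => ?_⟩
  have hnorm : ‖c • v₁‖ = |c| := by rw [norm_smul, hv₁, mul_one, Real.norm_eq_abs]
  have hlim := (hmain.norm.inv₀ (by rw [hnorm]; exact abs_ne_zero.2 hcne)).smul hmain
  rw [hnorm, smul_smul, ← div_eq_inv_mul] at hlim
  exact hlim.congr fun p => inv_norm_smul_smul_of_pos (by positivity) _
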